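/- The twisted antipode S̃ : A → A defined by S̃(a) := (id ⊗ f₁)(Δ(S(a))) is an involutive anti-automorphism of A: S̃ is linear and bijective, S̃(1) = 1, S̃(ab) = S̃(b) S̃(a) for all a, b ∈ A, and S̃(S̃(a)) = a for all a ∈ A. (Claim used in the proof of Theorem 4.5.) -/

import Mathlib

open scoped TensorProduct

noncomputable section

/-- Right slice map `(id ⊗ f) : M ⊗ A → M`. -/
def rslice {A M : Type*} [AddCommGroup A] [Module ℂ A] [AddCommGroup M] [Module ℂ M]
    (f : A →ₗ[ℂ] ℂ) : M ⊗[ℂ] A →ₗ[ℂ] M :=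
  (TensorProduct.rid ℂ M).toLinearMap ∘ₗ TensorProduct.map LinearMap.id f

/-- Left slice map `(f ⊗ id) : A ⊗ M → M`. -/
def lslice {A M : Type*} [AddCommGroup A] [Module ℂ A] [AddCommGroup M] [Module ℂ M]
    (f : A →ₗ[ℂ] ℂ) : A ⊗[ℂ] M →ₗ[ℂ] M :=
  (TensorProduct.lid ℂ M).toLinearMap ∘ₗ TensorProduct.map f LinearMap.id

/-- The pairing `(ω ⊗ η) : A ⊗ A → ℂ`. -/
def pair {A : Type*} [AddCommGroup A] [Module ℂ A] (ω η : A →ₗ[ℂ] ℂ) :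
    A ⊗[ℂ] A →ₗ[ℂ] ℂ :=
  LinearMap.mul' ℂ ℂ ∘ₗ TensorProduct.map ω η

/-- The twisted antipode `S̃(a) = (id ⊗ f₁)(Δ(S(a)))`. -/
def Stilde {A : Type*} [Ring A] [Algebra ℂ A]
    (Δ : A →ₐ[ℂ] A ⊗[ℂ] A) (S : A →ₗ[ℂ] A) (f₁ : A →ₐ[ℂ] ℂ) : A →ₗ[ℂ] A :=
  rslice f₁.toLinearMap ∘ₗ Δ.toLinearMap ∘ₗ S

section Slices

variable {A M N : Type*} [AddCommGroup A] [Module ℂ A] [AddCommGroup M] [Module ℂ M]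
  [AddCommGroup N] [Module ℂ N]

@[simp]
lemma rslice_tmul (f : A →ₗ[ℂ] ℂ) (m : M) (a : A) : rslice f (m ⊗ₜ[ℂ] a) = f a • m := by
  simp [rslice]

@[simp]
lemma lslice_tmul (f : A →ₗ[ℂ] ℂ) (a : A) (m : M) : lslice f (a ⊗ₜ[ℂ] m) = f a • m := by
  simp [lslice]

@[simp]
lemma pair_tmul (f g : A →ₗ[ℂ] ℂ) (a b : A) : pair f g (a ⊗ₜ[ℂ] b) = f a * g b := by
  simp [pair]

lemma rslice_map (f : N →ₗ[ℂ] ℂ) (u : A →ₗ[ℂ] M) (v : A →ₗ[ℂ] N) (t : A ⊗[ℂ] A) :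
    rslice f (TensorProduct.map u v t) = u (rslice (f ∘ₗ v) t) := by
  induction t with
  | zero => simp
  | tmul x y => simp
  | add x y hx hy => simp only [map_add, hx, hy]

lemma lslice_map (f : N →ₗ[ℂ] ℂ) (u : A →ₗ[ℂ] N) (v : A →ₗ[ℂ] M) (t : A ⊗[ℂ] A) :
    lslice f (TensorProduct.map u v t) = v (lslice (f ∘ₗ u) t) := by
  induction t with
  | zero => simp
  | tmul x y => simp
  | add x y hx hy => simp only [map_add, hx, hy]

lemma rslice_comm (f : A →ₗ[ℂ] ℂ) (t : A ⊗[ℂ] M) :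
    rslice f (TensorProduct.comm ℂ A M t) = lslice f t := by
  induction t with
  | zero => simp
  | tmul x y => simp
  | add x y hx hy => simp only [map_add, hx, hy]

lemma lslice_comm (f : A →ₗ[ℂ] ℂ) (t : M ⊗[ℂ] A) :
    lslice f (TensorProduct.comm ℂ M A t) = rslice f t := by
  induction t with
  | zero => simp
  | tmul x y => simp
  | add x y hx hy => simp only [map_add, hx, hy]

lemma apply_lslice (f g : A →ₗ[ℂ] ℂ) (t : A ⊗[ℂ] A) : g (lslice f t) = pair f g t := by
  induction t with
  | zero => simp
  | tmul x y => simp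
  | add x y hx hy => simp only [map_add, hx, hy]

lemma apply_rslice (f g : A →ₗ[ℂ] ℂ) (t : A ⊗[ℂ] A) : f (rslice g t) = pair f g t := by
  induction t with
  | zero => simp
  | tmul x y => simp [mul_comm]
  | add x y hx hy => simp only [map_add, hx, hy]

lemma rslice_pair_assoc (f g : A →ₗ[ℂ] ℂ) (t : (M ⊗[ℂ] A) ⊗[ℂ] A) :
    rslice (pair f g) (TensorProduct.assoc ℂ M A A t) = rslice f (rslice g t) := by
  suffices h : rslice (pair f g) ∘ₗ (TensorProduct.assoc ℂ M A A).toLinearMap =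
      rslice f ∘ₗ rslice g from LinearMap.congr_fun h t
  ext x y z
  simp [smul_smul, mul_comm]

lemma lslice_lslice_assoc (f g : A →ₗ[ℂ] ℂ) (t : (A ⊗[ℂ] A) ⊗[ℂ] M) :
    lslice f (lslice g (TensorProduct.assoc ℂ A A M t)) = lslice (pair g f) t := by
  suffices h : lslice f ∘ₗ lslice g ∘ₗ (TensorProduct.assoc ℂ A A M).toLinearMap =
      lslice (pair g f) from LinearMap.congr_fun h t
  ext x y z
  simp [smul_smul, mul_comm]

variable {Δ : A →ₗ[ℂ] A ⊗[ℂ] A}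

lemma rslice_comul_rslice_comul
    (coassoc : ∀ a, TensorProduct.assoc ℂ A A A (TensorProduct.map Δ LinearMap.id (Δ a)) =
      TensorProduct.map LinearMap.id Δ (Δ a)) (f g : A →ₗ[ℂ] ℂ) (a : A) :
    rslice f (Δ (rslice g (Δ a))) = rslice (pair f g ∘ₗ Δ) (Δ a) := by
  have h := rslice_map g Δ LinearMap.id (Δ a)
  rw [LinearMap.comp_id] at h
  rw [← h, ← rslice_pair_assoc, coassoc, rslice_map, LinearMap.id_apply]

lemma lslice_comul_lslice_comul
    (coassoc : ∀ a, TensorProduct.assoc ℂ A A A (TensorProduct.map Δ LinearMap.id (Δ a)) =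
      TensorProduct.map LinearMap.id Δ (Δ a)) (f g : A →ₗ[ℂ] ℂ) (a : A) :
    lslice f (Δ (lslice g (Δ a))) = lslice (pair g f ∘ₗ Δ) (Δ a) := by
  have h := lslice_map g LinearMap.id Δ (Δ a)
  rw [LinearMap.comp_id] at h
  rw [← h, ← coassoc, lslice_lslice_assoc, lslice_map, LinearMap.id_apply]

end Slices

lemma rslice_mul {A B : Type*} [Ring A] [Algebra ℂ A] [Ring B] [Algebra ℂ B] (f : A →ₐ[ℂ] ℂ)
    (s t : B ⊗[ℂ] A) :
    rslice f.toLinearMap (s * t) = rslice f.toLinearMap s * rslice f.toLinearMap t := by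
  induction s with
  | zero => simp
  | add x y hx hy => simp only [add_mul, map_add, hx, hy]
  | tmul x y =>
    induction t with
    | zero => simp
    | add x y hx hy => simp only [mul_add, map_add, hx, hy]
    | tmul z w => simp [smul_smul, mul_comm]

/-- Claim from the proof of Theorem 4.5: the twisted antipode
`S̃(a) = (id ⊗ f₁)(Δ(S(a)))` is an involutive anti-automorphism of `A`:
it is (linear and) bijective, unital, antimultiplicative and involutive. -/
theorem stmt16 {A : Type*} [Ring A] [Algebra ℂ A]
    (Δ : A →ₐ[ℂ] A ⊗[ℂ] A) (ε : A →ₐ[ℂ] ℂ) (S : A →ₗ[ℂ] A)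
    -- Hopf algebra axioms
    (coassoc : ∀ a, TensorProduct.assoc ℂ A A A
        (TensorProduct.map Δ.toLinearMap LinearMap.id (Δ a)) =
        TensorProduct.map LinearMap.id Δ.toLinearMap (Δ a))
    (counit_left : ∀ a, lslice ε.toLinearMap (Δ a) = a)
    (counit_right : ∀ a, rslice ε.toLinearMap (Δ a) = a)
    (antipode_left : ∀ a,
      LinearMap.mul' ℂ A (TensorProduct.map S LinearMap.id (Δ a)) = ε a • (1 : A))
    (antipode_right : ∀ a,
      LinearMap.mul' ℂ A (TensorProduct.map LinearMap.id S (Δ a)) = ε a • (1 : A))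
    (S_antimul : ∀ x y : A, S (x * y) = S y * S x)
    (S_one : S 1 = 1)
    -- `Δ ∘ S = flip ∘ (S ⊗ S) ∘ Δ`
    (ΔS : ∀ a, Δ (S a) = TensorProduct.comm ℂ A A (TensorProduct.map S S (Δ a)))
    -- Woronowicz's multiplicative functionals `f₁`, `f₋₁`
    (f₁ fm : A →ₐ[ℂ] ℂ)
    -- `f₁` and `f₋₁` are convolution inverses of each other, with unit `ε`
    (hconv₁ : ∀ a, pair f₁.toLinearMap fm.toLinearMap (Δ a) = ε a)
    (hconv₂ : ∀ a, pair fm.toLinearMap f₁.toLinearMap (Δ a) = ε a)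
    -- `f₁ ∘ S = f₋₁`
    (hfS : ∀ a, f₁ (S a) = fm a)
    -- `S²(a) = (f₁ ⊗ id ⊗ f₋₁)((Δ ⊗ id)(Δ(a)))`
    (hS2 : ∀ a, S (S a) =
      lslice f₁.toLinearMap (rslice fm.toLinearMap
        (TensorProduct.map Δ.toLinearMap LinearMap.id (Δ a)))) :
    Function.Bijective (Stilde Δ S f₁) ∧
    Stilde Δ S f₁ 1 = 1 ∧
    (∀ a b : A, Stilde Δ S f₁ (a * b) = Stilde Δ S f₁ b * Stilde Δ S f₁ a) ∧
    (∀ a : A, Stilde Δ S f₁ (Stilde Δ S f₁ a) = a) := by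
  have hSt (a : A) : Stilde Δ S f₁ a = S (lslice fm.toLinearMap (Δ a)) := by
    have hf : f₁.toLinearMap ∘ₗ S = fm.toLinearMap := LinearMap.ext hfS
    change rslice f₁.toLinearMap (Δ (S a)) = _
    rw [ΔS, rslice_comm, lslice_map, hf]
  have hSS (a : A) : S (S a) =
      lslice f₁.toLinearMap (Δ (rslice fm.toLinearMap (Δ a))) := by
    rw [hS2, rslice_map, LinearMap.comp_id]
    rfl
  have hR (f g : A →ₐ[ℂ] ℂ) (h : ∀ a, pair f.toLinearMap g.toLinearMap (Δ a) = ε a) (a : A) :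
      rslice f.toLinearMap (Δ (rslice g.toLinearMap (Δ a))) = a := by
    have hε : pair f.toLinearMap g.toLinearMap ∘ₗ Δ.toLinearMap = ε.toLinearMap :=
      LinearMap.ext h
    refine (rslice_comul_rslice_comul (Δ := Δ.toLinearMap) coassoc _ _ a).trans ?_
    rw [hε]
    exact counit_right a
  have hL (a : A) : lslice f₁.toLinearMap (Δ (lslice fm.toLinearMap (Δ a))) = a := by
    have hε : pair fm.toLinearMap f₁.toLinearMap ∘ₗ Δ.toLinearMap = ε.toLinearMap :=
      LinearMap.ext hconv₂
    refine (lslice_comul_lslice_comul (Δ := Δ.toLinearMap) coassoc _ _ a).trans ?_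
    rw [hε]
    exact counit_left a
  have hfmS : fm.toLinearMap ∘ₗ S = f₁.toLinearMap := by
    ext a
    change fm (S a) = f₁.toLinearMap a
    rw [← hfS, hSS, ← AlgHom.toLinearMap_apply, apply_lslice, ← apply_rslice, hR f₁ fm hconv₁]
  have hLS (a : A) : lslice fm.toLinearMap (Δ (S a)) = S (rslice f₁.toLinearMap (Δ a)) := by
    rw [ΔS, lslice_comm, rslice_map, hfmS]
  have hinv : Function.Involutive (Stilde Δ S f₁) := fun a ↦ by
    rw [hSt, hSt, hLS, hSS, hR fm f₁ hconv₂, hL]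
  refine ⟨hinv.bijective, ?_, fun a b ↦ ?_, hinv⟩
  · simp [Stilde, S_one, Algebra.TensorProduct.one_def]
  · simp [Stilde, S_antimul, rslice_mul]
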